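/- arXiv:2508.10324 — 9 statements merged into one kernel-verified Lean document; each statement's English description precedes it below -/
import Mathlib

section
/- Let α, γ be real numbers, let 0 < β ≤ 1, and define sequences (A_n), (B_n) by A_0 = 1, B_0 = 0, A_{n+1} = α·A_n + γ·B_n, B_{n+1} = γ·A_n + α·B_n. If |α+γ|^β + |α−γ|^β < 1, then the series ∑_{n=0}^∞ (|A_n|^β + |B_n|^β) converges. -/
theorem abs_half_add_rpow_le {β : ℝ} (hβ0 : 0 ≤ β) (hβ1 : β ≤ 1) (x y : ℝ) :
    |(x + y) / 2| ^ β ≤ |x| ^ β + |y| ^ β := by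
  have h : |(x + y) / 2| ≤ |x| + |y| := by
    rw [abs_div, abs_two]
    linarith [abs_add_le x y, abs_nonneg (x + y)]
  exact (Real.rpow_le_rpow (abs_nonneg _) h hβ0).trans
    (Real.rpow_add_le_add_rpow (abs_nonneg x) (abs_nonneg y) hβ0 hβ1)

theorem abs_pow_rpow_comm (x β : ℝ) (n : ℕ) : |x ^ n| ^ β = (|x| ^ β) ^ n := by
  rw [abs_pow, Real.rpow_pow_comm (abs_nonneg x)]

theorem stmt_2 (α γ β : ℝ) (hβ0 : 0 < β) (hβ1 : β ≤ 1) (A B : ℕ → ℝ)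
    (hA0 : A 0 = 1) (hB0 : B 0 = 0)
    (hA : ∀ n : ℕ, A (n + 1) = α * A n + γ * B n)
    (hB : ∀ n : ℕ, B (n + 1) = γ * A n + α * B n)
    (hαγ : |α + γ| ^ β + |α - γ| ^ β < 1) :
    Summable (fun n : ℕ => |A n| ^ β + |B n| ^ β) := by
  have closed_form : ∀ n, A n = ((α + γ) ^ n + (α - γ) ^ n) / 2 ∧
      B n = ((α + γ) ^ n + -(α - γ) ^ n) / 2 := by
    intro n
    induction n with
    | zero => simp [hA0, hB0]
    | succ n ih =>
      rw [hA, hB, ih.1, ih.2]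
      constructor <;> ring
  have hp : 0 ≤ |α + γ| ^ β := by positivity
  have hq : 0 ≤ |α - γ| ^ β := by positivity
  have hgeom : Summable fun n : ℕ => (|α + γ| ^ β) ^ n + (|α - γ| ^ β) ^ n :=
    (summable_geometric_of_lt_one hp (by linarith)).add
      (summable_geometric_of_lt_one hq (by linarith))
  refine (hgeom.add hgeom).of_nonneg_of_le (fun n => by positivity) fun n => ?_
  rw [(closed_form n).1, (closed_form n).2, ← abs_pow_rpow_comm, ← abs_pow_rpow_comm]
  refine add_le_add (abs_half_add_rpow_le hβ0.le hβ1 _ _) ?_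
  simpa only [abs_neg] using
    abs_half_add_rpow_le hβ0.le hβ1 ((α + γ) ^ n) (-(α - γ) ^ n)
end

section
/- Let X be an Abelian group and Y a β-homogeneous F-space with 0 < β ≤ 1. Let C > 0, let ω be an integer, let α, γ be real numbers with |α+γ|^β + |α−γ|^β < 1, and let f : X → Y satisfy ‖f(x) − α·f(ω•x) + γ·f(−ω•x)‖ ≤ C for all x ∈ X. Define A_0 = 1, B_0 = 0, A_{n+1} = α·A_n + γ·B_n, B_{n+1} = γ·A_n + α·B_n, and h(x, n) = ‖f(x) − A_n·f(ω^n • x) + B_n·f(−ω^n • x)‖. Then for all x ∈ X and n ∈ ℕ: (i) |h(x, n+1) − h(x, n)| ≤ C·(|A_n|^β + |B_n|^β), and (ii) h(x, n) ≤ C·(∑_{k=1}^∞ (|A_k|^β + |B_k|^β) + 1). -/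
/-- An even subadditive function changes along `z` by at most its value at `z`. -/
theorem abs_sub_le_of_subadditive {Y : Type*} [AddCommGroup Y] {N : Y → ℝ}
    (hadd : ∀ y z : Y, N (y + z) ≤ N y + N z) (hneg : ∀ y : Y, N (-y) = N y) (y z : Y) :
    |N (y + z) - N y| ≤ N z := by
  have h1 := hadd y z
  have h2 := hadd (y + z) (-z)
  rw [add_neg_cancel_right, hneg] at h2
  exact abs_le.2 ⟨by linarith, by linarith⟩

/-- The solution of the recursion is diagonalized by the sum and the difference. -/
theorem recursion_add_sub_eq_pow {α γ : ℝ} {A B : ℕ → ℝ} (hA0 : A 0 = 1) (hB0 : B 0 = 0)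
    (hA : ∀ n, A (n + 1) = α * A n + γ * B n) (hB : ∀ n, B (n + 1) = γ * A n + α * B n) (n : ℕ) :
    A n + B n = (α + γ) ^ n ∧ A n - B n = (α - γ) ^ n := by
  induction n with
  | zero => simp [hA0, hB0]
  | succ n ih =>
    rw [hA, hB, pow_succ, pow_succ, ← ih.1, ← ih.2]
    constructor <;> ring

/-- If `2 * |a|` is at most `|u| + |v|`, then `|a| ^ β` is at most `|u| ^ β + |v| ^ β`. -/
theorem abs_rpow_le_of_two_mul_le {β a u v : ℝ} (hβ0 : 0 < β) (h : 2 * |a| ≤ |u| + |v|) :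
    |a| ^ β ≤ |u| ^ β + |v| ^ β := by
  have hu : 0 ≤ |u| ^ β := by positivity
  have hv : 0 ≤ |v| ^ β := by positivity
  rcases le_total |u| |v| with huv | huv
  · have := Real.rpow_le_rpow (abs_nonneg a) (by linarith : |a| ≤ |v|) hβ0.le
    linarith
  · have := Real.rpow_le_rpow (abs_nonneg a) (by linarith : |a| ≤ |u|) hβ0.le
    linarith

theorem summable_abs_pow_rpow {β p : ℝ} (hp : |p| ^ β < 1) :
    Summable fun n : ℕ => |p ^ n| ^ β := by
  have h : (fun n : ℕ => |p ^ n| ^ β) = fun n => (|p| ^ β) ^ n := by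
    funext n
    rw [abs_pow, Real.rpow_pow_comm (abs_nonneg p)]
  rw [h]
  exact summable_geometric_of_lt_one (by positivity) hp

theorem summable_recursion_rpow {β α γ : ℝ} (hβ0 : 0 < β)
    (hαγ : |α + γ| ^ β + |α - γ| ^ β < 1) {A B : ℕ → ℝ} (hA0 : A 0 = 1) (hB0 : B 0 = 0)
    (hA : ∀ n, A (n + 1) = α * A n + γ * B n) (hB : ∀ n, B (n + 1) = γ * A n + α * B n) :
    Summable fun n => |A n| ^ β + |B n| ^ β := by
  have hp : 0 ≤ |α + γ| ^ β := by positivity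
  have hq : 0 ≤ |α - γ| ^ β := by positivity
  have hs := (summable_abs_pow_rpow (by linarith : |α + γ| ^ β < 1)).add
    (summable_abs_pow_rpow (by linarith : |α - γ| ^ β < 1))
  refine Summable.add (.of_nonneg_of_le (fun n => by positivity) (fun n => ?_) hs)
    (.of_nonneg_of_le (fun n => by positivity) (fun n => ?_) hs)
  all_goals
    obtain ⟨h1, h2⟩ := recursion_add_sub_eq_pow hA0 hB0 hA hB n
    refine abs_rpow_le_of_two_mul_le hβ0 ?_
    rw [← h1, ← h2]
  · have := abs_add_le (A n + B n) (A n - B n)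
    rwa [show A n + B n + (A n - B n) = 2 * A n by ring, abs_mul, abs_two] at this
  · have := abs_sub (A n + B n) (A n - B n)
    rwa [show A n + B n - (A n - B n) = 2 * B n by ring, abs_mul, abs_two] at this


theorem stmt_3 {X Y : Type*} [AddCommGroup X]
    [AddCommGroup Y] [Module ℝ Y] [MetricSpace Y] [CompleteSpace Y]
    (β : ℝ) (hβ0 : 0 < β) (hβ1 : β ≤ 1)
    (N : Y → ℝ)
    (hN_nonneg : ∀ y : Y, 0 ≤ N y)
    (hN_eq_zero : ∀ y : Y, N y = 0 ↔ y = 0)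
    (hN_add : ∀ y z : Y, N (y + z) ≤ N y + N z)
    (hN_smul : ∀ (t : ℝ) (y : Y), N (t • y) = |t| ^ β * N y)
    (hdist : ∀ y z : Y, dist y z = N (y - z))
    (C : ℝ) (hC : 0 < C) (ω : ℤ) (α γ : ℝ)
    (hαγ : |α + γ| ^ β + |α - γ| ^ β < 1)
    (f : X → Y)
    (hf : ∀ x : X, N (f x - α • f (ω • x) + γ • f ((-ω) • x)) ≤ C)
    (A B : ℕ → ℝ)
    (hA0 : A 0 = 1) (hB0 : B 0 = 0)
    (hA : ∀ n : ℕ, A (n + 1) = α * A n + γ * B n)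
    (hB : ∀ n : ℕ, B (n + 1) = γ * A n + α * B n)
    (h : X → ℕ → ℝ)
    (hh : ∀ (x : X) (n : ℕ),
      h x n = N (f x - A n • f ((ω ^ n) • x) + B n • f ((-(ω ^ n)) • x))) :
    ∀ (x : X) (n : ℕ),
      |h x (n + 1) - h x n| ≤ C * (|A n| ^ β + |B n| ^ β) ∧
      h x n ≤ C * ((∑' k : ℕ, (|A (k + 1)| ^ β + |B (k + 1)| ^ β)) + 1) := by
  have hneg (y : Y) : N (-y) = N y := by simpa using hN_smul (-1) y
  have hstep (x : X) (n : ℕ) : |h x (n + 1) - h x n| ≤ C * (|A n| ^ β + |B n| ^ β) := by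
    set D : X → Y := fun x => f x - α • f (ω • x) + γ • f ((-ω) • x) with hD
    have key : f x - A (n + 1) • f ((ω ^ (n + 1)) • x) + B (n + 1) • f ((-(ω ^ (n + 1))) • x) =
        (f x - A n • f ((ω ^ n) • x) + B n • f ((-(ω ^ n)) • x)) +
          (A n • D ((ω ^ n) • x) + (-B n) • D ((-(ω ^ n)) • x)) := by
      have e1 : ω * ω ^ n = ω ^ (n + 1) := (pow_succ' ω n).symm
      simp only [hD, smul_smul, neg_mul, mul_neg, neg_neg, e1, hA, hB]
      module
    rw [hh, hh, key]
    refine (abs_sub_le_of_subadditive hN_add hneg _ _).trans ((hN_add _ _).trans ?_)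
    rw [hN_smul, hN_smul, abs_neg]
    have h1 := mul_le_mul_of_nonneg_left (hf ((ω ^ n) • x)) (by positivity : 0 ≤ |A n| ^ β)
    have h2 := mul_le_mul_of_nonneg_left (hf ((-(ω ^ n)) • x)) (by positivity : 0 ≤ |B n| ^ β)
    simp only [hD]
    linarith
  have hsum := summable_recursion_rpow hβ0 hαγ hA0 hB0 hA hB
  intro x n
  refine ⟨hstep x n, ?_⟩
  have hpartial : h x n ≤ C * ∑ k ∈ Finset.range n, (|A k| ^ β + |B k| ^ β) := by
    induction n with
    | zero => simp [hh, hA0, hB0, (hN_eq_zero 0).2 rfl]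
    | succ n ih =>
      rw [Finset.sum_range_succ, mul_add]
      linarith [(abs_le.1 (hstep x n)).2]
  refine hpartial.trans (mul_le_mul_of_nonneg_left ?_ hC.le)
  refine (hsum.sum_le_tsum _ fun k _ => by positivity).trans_eq ?_
  rw [hsum.tsum_eq_zero_add, hA0, hB0, abs_one, abs_zero, Real.one_rpow,
    Real.zero_rpow hβ0.ne', add_zero, add_comm]
end

section
/- Let X be an Abelian group and Y a β-homogeneous F-space with 0 < β ≤ 1. Let C > 0, let ω be an integer, let α, γ be real numbers with |α+γ|^β + |α−γ|^β < 1, and let f : X → Y satisfy ‖f(x) − α·f(ω•x) + γ·f(−ω•x)‖ ≤ C for all x ∈ X. Define A_0 = 1, B_0 = 0, A_{n+1} = α·A_n + γ·B_n, B_{n+1} = γ·A_n + α·B_n, and g_n(x) = A_n·f(ω^n • x) − B_n·f(−ω^n • x). Then for every x ∈ X and n ∈ ℕ, ‖g_n(x) − g_{n+1}(x)‖ ≤ C·(|A_n|^β + |B_n|^β), and consequently (g_n(x))_{n∈ℕ} is a Cauchy sequence in Y. -/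
/-- If `u + v` and `u - v` are bounded by `R` in absolute value, then so is `u`. -/
lemma abs_le_of_abs_add_le_of_abs_sub_le {u v R : ℝ} (h₁ : |u + v| ≤ R) (h₂ : |u - v| ≤ R) :
    |u| ≤ R := by
  rw [abs_le] at *
  constructor <;> linarith [h₁.1, h₁.2, h₂.1, h₂.2]

/-- The sum of the sequences of a symmetric two-term linear recursion is geometric, and so is
their difference. -/
lemma add_and_sub_eq_pow_of_symmetric_recursion {α γ : ℝ} {A B : ℕ → ℝ}
    (hA0 : A 0 = 1) (hB0 : B 0 = 0)
    (hA : ∀ n : ℕ, A (n + 1) = α * A n + γ * B n)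
    (hB : ∀ n : ℕ, B (n + 1) = γ * A n + α * B n) (n : ℕ) :
    A n + B n = (α + γ) ^ n ∧ A n - B n = (α - γ) ^ n := by
  induction n with
  | zero => simp [hA0, hB0]
  | succ k ih =>
    rw [hA, hB, pow_succ, pow_succ, ← ih.1, ← ih.2]
    constructor <;> ring

theorem stmt_4 {X Y : Type*} [AddCommGroup X]
    [AddCommGroup Y] [Module ℝ Y] [MetricSpace Y] [CompleteSpace Y]
    (β : ℝ) (hβ0 : 0 < β) (hβ1 : β ≤ 1)
    (N : Y → ℝ)
    (hN_nonneg : ∀ y : Y, 0 ≤ N y)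
    (hN_eq_zero : ∀ y : Y, N y = 0 ↔ y = 0)
    (hN_add : ∀ y z : Y, N (y + z) ≤ N y + N z)
    (hN_smul : ∀ (t : ℝ) (y : Y), N (t • y) = |t| ^ β * N y)
    (hdist : ∀ y z : Y, dist y z = N (y - z))
    (C : ℝ) (hC : 0 < C) (ω : ℤ) (α γ : ℝ)
    (hαγ : |α + γ| ^ β + |α - γ| ^ β < 1)
    (f : X → Y)
    (hf : ∀ x : X, N (f x - α • f (ω • x) + γ • f ((-ω) • x)) ≤ C)
    (A B : ℕ → ℝ)
    (hA0 : A 0 = 1) (hB0 : B 0 = 0)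
    (hA : ∀ n : ℕ, A (n + 1) = α * A n + γ * B n)
    (hB : ∀ n : ℕ, B (n + 1) = γ * A n + α * B n)
    (g : ℕ → X → Y)
    (hg : ∀ (n : ℕ) (x : X),
      g n x = A n • f ((ω ^ n) • x) - B n • f ((-(ω ^ n)) • x)) :
    (∀ (x : X) (n : ℕ), N (g n x - g (n + 1) x) ≤ C * (|A n| ^ β + |B n| ^ β)) ∧
    (∀ x : X, CauchySeq (fun n : ℕ => g n x)) := by
  have hN_neg : ∀ y : Y, N (-y) = N y := fun y => by
    simpa using hN_smul (-1) y
  have step : ∀ (x : X) (n : ℕ),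
      N (g n x - g (n + 1) x) ≤ C * (|A n| ^ β + |B n| ^ β) := by
    intro x n
    have h₁ := hf ((ω ^ n) • x)
    have h₂ := hf ((-(ω ^ n)) • x)
    simp only [smul_smul, neg_mul, mul_neg, neg_neg, ← pow_succ'] at h₁ h₂
    have key : g n x - g (n + 1) x =
        A n • (f (ω ^ n • x) - α • f (ω ^ (n + 1) • x) + γ • f (-ω ^ (n + 1) • x)) +
        -(B n • (f (-ω ^ n • x) - α • f (-ω ^ (n + 1) • x) + γ • f (ω ^ (n + 1) • x))) := by
      rw [hg, hg, hA, hB]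
      module
    rw [key]
    refine (hN_add _ _).trans ?_
    rw [hN_neg, hN_smul, hN_smul, mul_add, mul_comm C, mul_comm C]
    gcongr
  refine ⟨step, fun x => ?_⟩
  set r := max |α + γ| |α - γ| with hr
  have hr0 : 0 ≤ r := (abs_nonneg _).trans (le_max_left _ _)
  have hrβ : r ^ β < 1 := by
    have h₁ := Real.rpow_nonneg (abs_nonneg (α + γ)) β
    have h₂ := Real.rpow_nonneg (abs_nonneg (α - γ)) β
    rcases max_choice |α + γ| |α - γ| with h | h <;> rw [hr, h] <;> linarith
  have hadd : ∀ n, |A n + B n| ≤ r ^ n := fun n => by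
    rw [(add_and_sub_eq_pow_of_symmetric_recursion hA0 hB0 hA hB n).1, abs_pow]
    exact pow_le_pow_left₀ (abs_nonneg _) (le_max_left _ _) n
  have hsub : ∀ n, |A n - B n| ≤ r ^ n := fun n => by
    rw [(add_and_sub_eq_pow_of_symmetric_recursion hA0 hB0 hA hB n).2, abs_pow]
    exact pow_le_pow_left₀ (abs_nonneg _) (le_max_right _ _) n
  have hpow : ∀ (u : ℝ) (n : ℕ), |u| ≤ r ^ n → |u| ^ β ≤ (r ^ β) ^ n := fun u n h => by
    rw [Real.rpow_pow_comm hr0]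
    exact Real.rpow_le_rpow (abs_nonneg _) h hβ0.le
  refine cauchySeq_of_le_geometric (r ^ β) (C * 2) hrβ fun n => ?_
  rw [hdist]
  have h₁ := hpow (A n) n (abs_le_of_abs_add_le_of_abs_sub_le (hadd n) (hsub n))
  have h₂ := hpow (B n) n (abs_le_of_abs_add_le_of_abs_sub_le
    (by rw [add_comm]; exact hadd n) (by rw [abs_sub_comm]; exact hsub n))
  calc N (g n x - g (n + 1) x) ≤ C * (|A n| ^ β + |B n| ^ β) := step x n
    _ ≤ C * ((r ^ β) ^ n + (r ^ β) ^ n) := by gcongr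
    _ = C * 2 * (r ^ β) ^ n := by ring
end

section
/- Let X be an Abelian group equipped with a binary relation ⊥ such that for all x ∈ X: 0 ⊥ 0 and x ⊥ −x. Let Y be a β-homogeneous F-space with 0 < β ≤ 1, let ε ≥ 0, and let M be a real number with M ≠ 0 and M ≠ 1/2. If f : X → Y satisfies ‖f(x+y) − M·(f(x) + f(y))‖ ≤ ε whenever x ⊥ y, then for every x ∈ X, ‖f(2•x) + f(−2•x)‖ ≤ ((1/|1 − 2M|^β + 1)/|M|^β)·ε. -/
theorem stmt_8 {X Y : Type*} [AddCommGroup X]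
    [AddCommGroup Y] [Module ℝ Y] [MetricSpace Y] [CompleteSpace Y]
    (β : ℝ) (hβ0 : 0 < β) (hβ1 : β ≤ 1)
    (N : Y → ℝ)
    (hN_nonneg : ∀ y : Y, 0 ≤ N y)
    (hN_eq_zero : ∀ y : Y, N y = 0 ↔ y = 0)
    (hN_add : ∀ y z : Y, N (y + z) ≤ N y + N z)
    (hN_smul : ∀ (t : ℝ) (y : Y), N (t • y) = |t| ^ β * N y)
    (hdist : ∀ y z : Y, dist y z = N (y - z))
    (perp : X → X → Prop)
    (hperp00 : perp 0 0)
    (hperp_neg : ∀ x : X, perp x (-x))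
    (ε : ℝ) (hε : 0 ≤ ε)
    (M : ℝ) (hM0 : M ≠ 0) (hMhalf : M ≠ 1 / 2)
    (f : X → Y)
    (hf : ∀ x y : X, perp x y → N (f (x + y) - M • (f x + f y)) ≤ ε) :
    ∀ x : X,
      N (f ((2 : ℤ) • x) + f ((-2 : ℤ) • x)) ≤
        ((1 / |1 - 2 * M| ^ β + 1) / |M| ^ β) * ε := by
  intro x
  have hM : 0 < |M| ^ β := Real.rpow_pos_of_pos (abs_pos.mpr hM0) β
  have hM' : 0 < |1 - 2 * M| ^ β :=
    Real.rpow_pos_of_pos (abs_pos.mpr fun h => hMhalf (by linarith)) β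
  have h_zero : N (f 0) ≤ 1 / |1 - 2 * M| ^ β * ε := by
    have h := hf 0 0 hperp00
    have e : f (0 + 0) - M • (f 0 + f 0) = (1 - 2 * M) • f 0 := by
      rw [add_zero]
      module
    rw [e, hN_smul] at h
    rw [one_div_mul_eq_div, le_div_iff₀ hM']
    linarith
  have h_neg : (-2 : ℤ) • x = -((2 : ℤ) • x) := neg_smul _ _
  have h := hf ((2 : ℤ) • x) (-((2 : ℤ) • x)) (hperp_neg _)
  rw [add_neg_cancel] at h
  rw [h_neg]
  set g := f ((2 : ℤ) • x) + f (-((2 : ℤ) • x))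
  have h_sum : |M| ^ β * N g ≤ N (f 0) + ε := by
    have h_add := hN_add (f 0) ((-1 : ℝ) • (f 0 - M • g))
    have e : f 0 + (-1 : ℝ) • (f 0 - M • g) = M • g := by module
    rw [e, hN_smul, hN_smul, abs_neg, abs_one, Real.one_rpow, one_mul] at h_add
    linarith
  rw [div_mul_eq_mul_div, le_div_iff₀ hM]
  linarith
end

section
/- Let X be an Abelian group equipped with a binary relation ⊥ such that x ⊥ y implies (2^n)•x ⊥ (2^n)•y and −(2^n)•x ⊥ −(2^n)•y for all n ∈ ℕ. Let Y be a β-homogeneous F-space with 0 < β ≤ 1, let ε ≥ 0, let M be a real number, and suppose f : X → Y satisfies ‖f(x+y) − M·(f(x) + f(y))‖ ≤ ε whenever x ⊥ y. For n ∈ ℕ define g_n(x) = ((2^n + 1)/(2·4^n))·f(2^n • x) − ((2^n − 1)/(2·4^n))·f(−2^n • x). Then for all x, y ∈ X with x ⊥ y and all n ∈ ℕ, ‖g_n(x+y) − M·(g_n(x) + g_n(y))‖ ≤ (((2^n + 1)/(2·4^n))^β + ((2^n − 1)/(2·4^n))^β)·ε. -/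
theorem stmt_10 {X Y : Type*} [AddCommGroup X]
    [AddCommGroup Y] [Module ℝ Y] [MetricSpace Y] [CompleteSpace Y]
    (β : ℝ) (hβ0 : 0 < β) (hβ1 : β ≤ 1)
    (N : Y → ℝ)
    (hN_nonneg : ∀ y : Y, 0 ≤ N y)
    (hN_eq_zero : ∀ y : Y, N y = 0 ↔ y = 0)
    (hN_add : ∀ y z : Y, N (y + z) ≤ N y + N z)
    (hN_smul : ∀ (t : ℝ) (y : Y), N (t • y) = |t| ^ β * N y)
    (hdist : ∀ y z : Y, dist y z = N (y - z))
    (perp : X → X → Prop)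
    (hperp_pow : ∀ x y : X, perp x y → ∀ n : ℕ,
      perp (((2 : ℤ) ^ n) • x) (((2 : ℤ) ^ n) • y) ∧
      perp ((-((2 : ℤ) ^ n)) • x) ((-((2 : ℤ) ^ n)) • y))
    (ε : ℝ) (hε : 0 ≤ ε)
    (M : ℝ)
    (f : X → Y)
    (hf : ∀ x y : X, perp x y → N (f (x + y) - M • (f x + f y)) ≤ ε)
    (g : ℕ → X → Y)
    (hg : ∀ (n : ℕ) (x : X),
      g n x = (((2 : ℝ) ^ n + 1) / (2 * 4 ^ n)) • f (((2 : ℤ) ^ n) • x) -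
        (((2 : ℝ) ^ n - 1) / (2 * 4 ^ n)) • f ((-((2 : ℤ) ^ n)) • x)) :
    ∀ x y : X, perp x y → ∀ n : ℕ,
      N (g n (x + y) - M • (g n x + g n y)) ≤
        ((((2 : ℝ) ^ n + 1) / (2 * 4 ^ n)) ^ β +
          (((2 : ℝ) ^ n - 1) / (2 * 4 ^ n)) ^ β) * ε := by
  intro x y hxy n
  obtain ⟨hpos, hneg⟩ := hperp_pow x y hxy n
  have h_pos := hf _ _ hpos
  have h_neg := hf _ _ hneg
  have ha : 0 ≤ ((2 : ℝ) ^ n + 1) / (2 * 4 ^ n) := by positivity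
  have hb : 0 ≤ ((2 : ℝ) ^ n - 1) / (2 * 4 ^ n) :=
    div_nonneg (sub_nonneg.2 (one_le_pow₀ one_le_two)) (by positivity)
  rw [hg, hg, hg, smul_add ((2 : ℤ) ^ n) x y, smul_add (-(2 : ℤ) ^ n) x y]
  generalize ((2 : ℝ) ^ n + 1) / (2 * 4 ^ n) = a at *
  generalize ((2 : ℝ) ^ n - 1) / (2 * 4 ^ n) = b at *
  generalize ((2 : ℤ) ^ n) • x = u at *
  generalize ((2 : ℤ) ^ n) • y = v at *
  generalize (-(2 : ℤ) ^ n) • x = p at *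
  generalize (-(2 : ℤ) ^ n) • y = q at *
  calc N (a • f (u + v) - b • f (p + q) - M • (a • f u - b • f p + (a • f v - b • f q)))
      = N (a • (f (u + v) - M • (f u + f v)) +
          (-b) • (f (p + q) - M • (f p + f q))) := by
        congr 1
        module
    _ ≤ |a| ^ β * N (f (u + v) - M • (f u + f v)) +
          |-b| ^ β * N (f (p + q) - M • (f p + f q)) := by
        simpa only [hN_smul] using hN_add (a • _) ((-b) • _)
    _ ≤ a ^ β * ε + b ^ β * ε := by
        rw [abs_neg, abs_of_nonneg ha, abs_of_nonneg hb]
        gcongr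
    _ = (a ^ β + b ^ β) * ε := by ring
end

section
/- Let X be an Abelian group equipped with a binary relation ⊥ such that for all x ∈ X: 0 ⊥ 0 and x ⊥ x. Let Y be a β-homogeneous F-space with 0 < β ≤ 1, let ε ≥ 0, and let λ be a nonzero integer. If f : X → Y satisfies ‖f(λ•x + λ•y) + f(λ•x − λ•y) − 2λ²·(f(x) + f(y))‖ ≤ ε whenever x ⊥ y, then for every x ∈ X, ‖f((2λ)•x) − 4λ²·f(x)‖ ≤ (1/|2 − 4λ²|^β + 1)·ε. -/
theorem stmt_13 {X Y : Type*} [AddCommGroup X]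
    [AddCommGroup Y] [Module ℝ Y] [MetricSpace Y] [CompleteSpace Y]
    (β : ℝ) (hβ0 : 0 < β) (hβ1 : β ≤ 1)
    (N : Y → ℝ)
    (hN_nonneg : ∀ y : Y, 0 ≤ N y)
    (hN_eq_zero : ∀ y : Y, N y = 0 ↔ y = 0)
    (hN_add : ∀ y z : Y, N (y + z) ≤ N y + N z)
    (hN_smul : ∀ (t : ℝ) (y : Y), N (t • y) = |t| ^ β * N y)
    (hdist : ∀ y z : Y, dist y z = N (y - z))
    (perp : X → X → Prop)
    (hperp00 : perp 0 0)
    (hperp_self : ∀ x : X, perp x x)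
    (ε : ℝ) (hε : 0 ≤ ε)
    (l : ℤ) (hl : l ≠ 0)
    (f : X → Y)
    (hf : ∀ x y : X, perp x y →
      N (f (l • x + l • y) + f (l • x - l • y) -
        (2 * (l : ℝ) ^ 2) • (f x + f y)) ≤ ε) :
    ∀ x : X,
      N (f ((2 * l) • x) - (4 * (l : ℝ) ^ 2) • f x) ≤
        (1 / |2 - 4 * (l : ℝ) ^ 2| ^ β + 1) * ε := by
  intro x
  have hl1 : (1 : ℝ) ≤ (l : ℝ) ^ 2 := by
    exact_mod_cast Int.add_one_le_iff.mpr (sq_pos_of_ne_zero hl)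
  have hc : 0 < |2 - 4 * (l : ℝ) ^ 2| ^ β :=
    Real.rpow_pos_of_pos (abs_pos.mpr (by linarith)) β
  have h0 := hf 0 0 hperp00
  have e0 : f (l • (0 : X) + l • (0 : X)) + f (l • (0 : X) - l • (0 : X)) -
      (2 * (l : ℝ) ^ 2) • (f 0 + f 0) = (2 - 4 * (l : ℝ) ^ 2) • f 0 := by
    simp only [smul_zero, add_zero, sub_zero]
    module
  rw [e0, hN_smul] at h0
  have hf0 : N (f 0) ≤ 1 / |2 - 4 * (l : ℝ) ^ 2| ^ β * ε := by
    rw [one_div_mul_eq_div, le_div_iff₀ hc]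
    linarith
  have hneg : N ((-1 : ℝ) • f 0) = N (f 0) := by
    rw [hN_smul]
    simp
  have hx := hf x x (hperp_self x)
  have ex : l • x + l • x = (2 * l) • x := by module
  rw [ex, sub_self] at hx
  have key : f ((2 * l) • x) - (4 * (l : ℝ) ^ 2) • f x =
      (f ((2 * l) • x) + f 0 - (2 * (l : ℝ) ^ 2) • (f x + f x)) + (-1 : ℝ) • f 0 := by
    module
  rw [key]
  linarith [hN_add (f ((2 * l) • x) + f 0 - (2 * (l : ℝ) ^ 2) • (f x + f x)) ((-1 : ℝ) • f 0)]
end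

section
/- Let X be an Abelian group equipped with a binary relation ⊥ such that for all x ∈ X: 0 ⊥ 0 and x ⊥ −x. Let Y be a β-homogeneous F-space with 0 < β ≤ 1, let ε ≥ 0, and let λ be a nonzero integer. If f : X → Y satisfies ‖f(λ•x + λ•y) + f(λ•x − λ•y) − 2λ²·(f(x) + f(y))‖ ≤ ε whenever x ⊥ y, then for every x ∈ X, ‖f((2λ)•x) − 2λ²·(f(x) + f(−x))‖ ≤ (1/|2 − 4λ²|^β + 1)·ε. -/
theorem stmt_14 {X Y : Type*} [AddCommGroup X]
    [AddCommGroup Y] [Module ℝ Y] [MetricSpace Y] [CompleteSpace Y]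
    (β : ℝ) (hβ0 : 0 < β) (hβ1 : β ≤ 1)
    (N : Y → ℝ)
    (hN_nonneg : ∀ y : Y, 0 ≤ N y)
    (hN_eq_zero : ∀ y : Y, N y = 0 ↔ y = 0)
    (hN_add : ∀ y z : Y, N (y + z) ≤ N y + N z)
    (hN_smul : ∀ (t : ℝ) (y : Y), N (t • y) = |t| ^ β * N y)
    (hdist : ∀ y z : Y, dist y z = N (y - z))
    (perp : X → X → Prop)
    (hperp00 : perp 0 0)
    (hperp_neg : ∀ x : X, perp x (-x))
    (ε : ℝ) (hε : 0 ≤ ε)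
    (l : ℤ) (hl : l ≠ 0)
    (f : X → Y)
    (hf : ∀ x y : X, perp x y →
      N (f (l • x + l • y) + f (l • x - l • y) -
        (2 * (l : ℝ) ^ 2) • (f x + f y)) ≤ ε) :
    ∀ x : X,
      N (f ((2 * l) • x) - (2 * (l : ℝ) ^ 2) • (f x + f (-x))) ≤
        (1 / |2 - 4 * (l : ℝ) ^ 2| ^ β + 1) * ε := by
  intro x
  have h_coeff : (2 - 4 * (l : ℝ) ^ 2) ≠ 0 := by
    have h : (1 : ℝ) ≤ (l : ℝ) ^ 2 := by
      exact_mod_cast Int.add_one_le_iff.mpr (pow_pos (abs_pos.mpr hl) 2 |>.trans_eq (sq_abs l))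
    linarith
  have h_pos : 0 < |2 - 4 * (l : ℝ) ^ 2| ^ β := Real.rpow_pos_of_pos (abs_pos.mpr h_coeff) β
  have h_zero : N (f 0) ≤ ε / |2 - 4 * (l : ℝ) ^ 2| ^ β := by
    rw [le_div_iff₀' h_pos, ← hN_smul]
    have h := hf 0 0 hperp00
    simp only [smul_zero, add_zero, sub_zero] at h
    have h_eq : (2 - 4 * (l : ℝ) ^ 2) • f 0 =
        f 0 + f 0 - (2 * (l : ℝ) ^ 2) • (f 0 + f 0) := by module
    rwa [h_eq]
  have h_neg : N (-f 0) = N (f 0) := by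
    simpa using hN_smul (-1) (f 0)
  have h_main := hf x (-x) (hperp_neg x)
  have h_sum : l • x + l • -x = 0 := by simp
  have h_diff : l • x - l • -x = (2 * l) • x := by module
  rw [h_sum, h_diff] at h_main
  calc N (f ((2 * l) • x) - (2 * (l : ℝ) ^ 2) • (f x + f (-x)))
      = N (-f 0 + (f 0 + f ((2 * l) • x) - (2 * (l : ℝ) ^ 2) • (f x + f (-x)))) := by
        congr 1
        abel
    _ ≤ ε / |2 - 4 * (l : ℝ) ^ 2| ^ β + ε :=
        (hN_add _ _).trans (add_le_add (h_neg.trans_le h_zero) h_main)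
    _ = (1 / |2 - 4 * (l : ℝ) ^ 2| ^ β + 1) * ε := by ring
end

section
/- Let X be an Abelian group equipped with a binary relation ⊥ such that for all x ∈ X: 0 ⊥ 0, x ⊥ x, −x ⊥ −x, and x ⊥ −x. Let Y be a β-homogeneous F-space with 0 < β ≤ 1, let ε ≥ 0, and let λ be a nonzero integer. If f : X → Y satisfies ‖f(λ•x + λ•y) + f(λ•x − λ•y) − 2λ²·(f(x) + f(y))‖ ≤ ε whenever x ⊥ y, then for every x ∈ X, ‖f(x) − (3/(8λ²))·f((2λ)•x) + (1/(8λ²))·f(−(2λ)•x)‖ ≤ (2 + 2^β)·(1/(8λ²))^β·(1/|2 − 4λ²|^β + 1)·ε. -/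
theorem stmt_15 {X Y : Type*} [AddCommGroup X]
    [AddCommGroup Y] [Module ℝ Y] [MetricSpace Y] [CompleteSpace Y]
    (β : ℝ) (hβ0 : 0 < β) (hβ1 : β ≤ 1)
    (N : Y → ℝ)
    (hN_nonneg : ∀ y : Y, 0 ≤ N y)
    (hN_eq_zero : ∀ y : Y, N y = 0 ↔ y = 0)
    (hN_add : ∀ y z : Y, N (y + z) ≤ N y + N z)
    (hN_smul : ∀ (t : ℝ) (y : Y), N (t • y) = |t| ^ β * N y)
    (hdist : ∀ y z : Y, dist y z = N (y - z))
    (perp : X → X → Prop)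
    (hperp00 : perp 0 0)
    (hperp_self : ∀ x : X, perp x x)
    (hperp_neg_self : ∀ x : X, perp (-x) (-x))
    (hperp_neg : ∀ x : X, perp x (-x))
    (ε : ℝ) (hε : 0 ≤ ε)
    (l : ℤ) (hl : l ≠ 0)
    (f : X → Y)
    (hf : ∀ x y : X, perp x y →
      N (f (l • x + l • y) + f (l • x - l • y) -
        (2 * (l : ℝ) ^ 2) • (f x + f y)) ≤ ε) :
    ∀ x : X,
      N (f x - (3 / (8 * (l : ℝ) ^ 2)) • f ((2 * l) • x) +
          (1 / (8 * (l : ℝ) ^ 2)) • f ((-(2 * l)) • x)) ≤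
        (2 + 2 ^ β) * (1 / (8 * (l : ℝ) ^ 2)) ^ β *
          (1 / |2 - 4 * (l : ℝ) ^ 2| ^ β + 1) * ε := by
  intro x
  have hl2 : (1 : ℝ) ≤ (l : ℝ) ^ 2 := by
    have h : (1 : ℤ) ≤ l ^ 2 := Int.add_one_le_iff.mpr (sq_pos_iff.mpr hl)
    exact_mod_cast h
  have hu : l • x + l • x = (2 * l) • x := by rw [← add_smul, two_mul]
  have hu_neg : l • (-x) + l • (-x) = (-(2 * l)) • x := by
    rw [← add_smul, smul_neg, neg_smul, two_mul]
  have hu_sub : l • x - l • (-x) = (2 * l) • x := by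
    rw [smul_neg, sub_neg_eq_add, hu]
  have hA := hf x x (hperp_self x)
  have hB := hf (-x) (-x) (hperp_neg_self x)
  have hC := hf x (-x) (hperp_neg x)
  have hD := hf 0 0 hperp00
  rw [hu, sub_self] at hA
  rw [hu_neg, sub_self] at hB
  rw [hu_sub, smul_neg, add_neg_cancel] at hC
  rw [smul_zero, add_zero, sub_zero] at hD
  set a : ℝ := (l : ℝ) ^ 2
  set A := f ((2 * l) • x) + f 0 - (2 * a) • (f x + f x)
  set B := f ((-(2 * l)) • x) + f 0 - (2 * a) • (f (-x) + f (-x))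
  set C := f 0 + f ((2 * l) • x) - (2 * a) • (f x + f (-x))
  have ha : a ≠ 0 := by positivity
  have hd : 0 < |2 - 4 * a| ^ β :=
    Real.rpow_pos_of_pos (abs_pos.mpr (by linarith)) β
  have hf0 : N (f 0) ≤ 1 / |2 - 4 * a| ^ β * ε := by
    have h : f 0 + f 0 - (2 * a) • (f 0 + f 0) = (2 - 4 * a) • f 0 := by module
    rw [h, hN_smul] at hD
    rwa [one_div, inv_mul_eq_div, le_div_iff₀' hd]
  have hN_neg (y : Y) : N (-y) = N y := by
    simpa using hN_smul (-1) y
  have hN_two (y : Y) : N ((2 : ℝ) • y) = 2 ^ β * N y := by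
    simpa using hN_smul 2 y
  have key : f x - (3 / (8 * a)) • f ((2 * l) • x) + (1 / (8 * a)) • f ((-(2 * l)) • x) =
      (1 / (8 * a)) • (-A + B + -((2 : ℝ) • C) + (2 : ℝ) • f 0) := by
    simp only [A, B, C]
    match_scalars <;> field_simp <;> ring
  have h2 : (0 : ℝ) ≤ 2 ^ β := by positivity
  have hsum : N (-A + B + -((2 : ℝ) • C) + (2 : ℝ) • f 0) ≤
      (2 + 2 ^ β) * (1 / |2 - 4 * a| ^ β + 1) * ε := by
    have h₁ := hN_add (-A + B + -((2 : ℝ) • C)) ((2 : ℝ) • f 0)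
    have h₂ := hN_add (-A + B) (-((2 : ℝ) • C))
    have h₃ := hN_add (-A) B
    rw [hN_neg] at h₂ h₃
    rw [hN_two] at h₁ h₂
    have hC' := mul_le_mul_of_nonneg_left hC h2
    have hf0' := mul_le_mul_of_nonneg_left hf0 h2
    have hpos : 0 ≤ 1 / |2 - 4 * a| ^ β * ε := by positivity
    linarith
  have hpos : (0 : ℝ) < 1 / (8 * a) := by positivity
  rw [key, hN_smul, abs_of_pos hpos]
  calc (1 / (8 * a)) ^ β * N (-A + B + -((2 : ℝ) • C) + (2 : ℝ) • f 0)
      ≤ (1 / (8 * a)) ^ β * ((2 + 2 ^ β) * (1 / |2 - 4 * a| ^ β + 1) * ε) := by gcongr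
    _ = _ := by ring
end

section
/- Let X be an Abelian group equipped with a binary relation ⊥ such that x ⊥ y implies ((2λ)^n)•x ⊥ ((2λ)^n)•y and −((2λ)^n)•x ⊥ −((2λ)^n)•y for all n ∈ ℕ. Let Y be a β-homogeneous F-space with 0 < β ≤ 1, let ε ≥ 0, let λ be a nonzero integer, and suppose f : X → Y satisfies ‖f(λ•x + λ•y) + f(λ•x − λ•y) − 2λ²·(f(x) + f(y))‖ ≤ ε whenever x ⊥ y. For n ∈ ℕ define g_n(x) = ((2^n + 1)/(4^n·λ^{2n}))·f((2λ)^n • x) − ((2^n − 1)/(4^n·λ^{2n}))·f(−(2λ)^n • x). Then for all x, y ∈ X with x ⊥ y and all n ∈ ℕ, ‖g_n(λ•x + λ•y) + g_n(λ•x − λ•y) − 2λ²·(g_n(x) + g_n(y))‖ ≤ (|(2^n + 1)/(4^n·λ^{2n})|^β + |(2^n − 1)/(4^n·λ^{2n})|^β)·ε. -/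
theorem stmt_16 {X Y : Type*} [AddCommGroup X]
    [AddCommGroup Y] [Module ℝ Y] [MetricSpace Y] [CompleteSpace Y]
    (β : ℝ) (hβ0 : 0 < β) (hβ1 : β ≤ 1)
    (N : Y → ℝ)
    (hN_nonneg : ∀ y : Y, 0 ≤ N y)
    (hN_eq_zero : ∀ y : Y, N y = 0 ↔ y = 0)
    (hN_add : ∀ y z : Y, N (y + z) ≤ N y + N z)
    (hN_smul : ∀ (t : ℝ) (y : Y), N (t • y) = |t| ^ β * N y)
    (hdist : ∀ y z : Y, dist y z = N (y - z))
    (l : ℤ) (hl : l ≠ 0)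
    (perp : X → X → Prop)
    (hperp_pow : ∀ x y : X, perp x y → ∀ n : ℕ,
      perp (((2 * l) ^ n) • x) (((2 * l) ^ n) • y) ∧
      perp ((-((2 * l) ^ n)) • x) ((-((2 * l) ^ n)) • y))
    (ε : ℝ) (hε : 0 ≤ ε)
    (f : X → Y)
    (hf : ∀ x y : X, perp x y →
      N (f (l • x + l • y) + f (l • x - l • y) -
        (2 * (l : ℝ) ^ 2) • (f x + f y)) ≤ ε)
    (g : ℕ → X → Y)
    (hg : ∀ (n : ℕ) (x : X),
      g n x = (((2 : ℝ) ^ n + 1) / (4 ^ n * (l : ℝ) ^ (2 * n))) • f (((2 * l) ^ n) • x) -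
        (((2 : ℝ) ^ n - 1) / (4 ^ n * (l : ℝ) ^ (2 * n))) • f ((-((2 * l) ^ n)) • x)) :
    ∀ x y : X, perp x y → ∀ n : ℕ,
      N (g n (l • x + l • y) + g n (l • x - l • y) -
          (2 * (l : ℝ) ^ 2) • (g n x + g n y)) ≤
        (|((2 : ℝ) ^ n + 1) / (4 ^ n * (l : ℝ) ^ (2 * n))| ^ β +
         |((2 : ℝ) ^ n - 1) / (4 ^ n * (l : ℝ) ^ (2 * n))| ^ β) * ε := by
  intro x y hxy n
  have hcomm : ∀ m : ℤ, m • (l • x + l • y) = l • (m • x) + l • (m • y) ∧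
      m • (l • x - l • y) = l • (m • x) - l • (m • y) := fun m => by
    simp only [smul_add, smul_sub, smul_comm m l, and_self]
  obtain ⟨hpos, hneg⟩ := hperp_pow x y hxy n
  have hfpos := hf _ _ hpos
  have hfneg := hf _ _ hneg
  simp only [hg, (hcomm _).1, (hcomm _).2]
  generalize ((2 : ℝ) ^ n + 1) / (4 ^ n * (l : ℝ) ^ (2 * n)) = a
  generalize ((2 : ℝ) ^ n - 1) / (4 ^ n * (l : ℝ) ^ (2 * n)) = b
  generalize ((2 * l) ^ n) • x = u at *
  generalize ((2 * l) ^ n) • y = v at *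
  generalize (-((2 * l) ^ n)) • x = u' at *
  generalize (-((2 * l) ^ n)) • y = v' at *
  set A := f (l • u + l • v) + f (l • u - l • v) - (2 * (l : ℝ) ^ 2) • (f u + f v) with hA
  set B := f (l • u' + l • v') + f (l • u' - l • v') - (2 * (l : ℝ) ^ 2) • (f u' + f v') with hB
  calc _ = N (a • A + (-b) • B) := by
        congr 1
        rw [hA, hB]
        module
    _ ≤ N (a • A) + N ((-b) • B) := hN_add _ _
    _ = |a| ^ β * N A + |b| ^ β * N B := by rw [hN_smul, hN_smul, abs_neg]
    _ ≤ |a| ^ β * ε + |b| ^ β * ε := by gcongr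
    _ = _ := by ring
end
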